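/- arXiv:2312.16978 — 4 statements merged into one kernel-verified Lean document; each statement's English description precedes it below -/
import Mathlib

section
/- Let k ≥ 1, let λ_1, …, λ_k be real numbers and w_1, …, w_k, h_1, …, h_k complex numbers. Define the (2k+1)×(2k+1) complex matrices Λ = diag(jλ_1, −jλ_1, …, jλ_k, −jλ_k, 1), Ẽ = diag(1, 1, …, 1, 0), the column vector B̃ = (w_1, w_1*, …, w_k, w_k*, 1)ᵀ, the row vector C̃ = (h_1, h_1*, …, h_k, h_k*, 0), the all-ones row vector R̃ = (1, 1, …, 1), and Ã = Λ − B̃R̃. Then for every s ∈ ℂ such that s ≠ ±jλ_i for all i, such that D(s) := Σ_{i=1}^k ( w_i/(s − jλ_i) + w_i*/(s + jλ_i) ) ≠ 0, and such that the matrix sẼ − Ã is invertible, one has C̃ (sẼ − Ã)⁻¹ B̃ = N(s)/D(s), where N(s) = Σ_{i=1}^k ( h_i w_i/(s − jλ_i) + (h_i w_i)*/(s + jλ_i) ). -/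
open Matrix

/-- The diagonal matrix `Λ = diag(jλ₁, −jλ₁, …, jλ_k, −jλ_k, 1)` of size `2k+1`. -/
noncomputable def LamTil (k : ℕ) (lam : Fin k → ℝ) :
    Matrix (Fin (2 * k + 1)) (Fin (2 * k + 1)) ℂ :=
  Matrix.diagonal fun i =>
    if h : (i : ℕ) < 2 * k then
      (if (i : ℕ) % 2 = 0 then Complex.I * (lam ⟨(i : ℕ) / 2, by omega⟩ : ℂ)
       else -(Complex.I * (lam ⟨(i : ℕ) / 2, by omega⟩ : ℂ)))
    else 1

/-- The matrix `Ẽ = diag(1, …, 1, 0)` of size `2k+1`. -/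
noncomputable def ETil (k : ℕ) : Matrix (Fin (2 * k + 1)) (Fin (2 * k + 1)) ℂ :=
  Matrix.diagonal fun i => if (i : ℕ) < 2 * k then 1 else 0

/-- The column vector `B̃ = (w₁, w₁*, …, w_k, w_k*, 1)ᵀ`. -/
noncomputable def BTil (k : ℕ) (w : Fin k → ℂ) : Fin (2 * k + 1) → ℂ := fun i =>
  if h : (i : ℕ) < 2 * k then
    (if (i : ℕ) % 2 = 0 then w ⟨(i : ℕ) / 2, by omega⟩
     else (starRingEnd ℂ) (w ⟨(i : ℕ) / 2, by omega⟩))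
  else 1

/-- The row vector `C̃ = (h₁, h₁*, …, h_k, h_k*, 0)`. -/
noncomputable def CTil (k : ℕ) (h : Fin k → ℂ) : Fin (2 * k + 1) → ℂ := fun i =>
  if hi : (i : ℕ) < 2 * k then
    (if (i : ℕ) % 2 = 0 then h ⟨(i : ℕ) / 2, by omega⟩
     else (starRingEnd ℂ) (h ⟨(i : ℕ) / 2, by omega⟩))
  else 0

/-- The all-ones row vector `R̃`. -/
def RTil (k : ℕ) : Fin (2 * k + 1) → ℂ := fun _ => 1

/-- The vector `(f₁, g₁, …, f_k, g_k, c)` of length `2k+1`. -/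
def interleave {α : Type*} {k : ℕ} (f g : Fin k → α) (c : α) (i : Fin (2 * k + 1)) : α :=
  if h : (i : ℕ) < 2 * k then
    (if (i : ℕ) % 2 = 0 then f ⟨(i : ℕ) / 2, by omega⟩ else g ⟨(i : ℕ) / 2, by omega⟩)
  else c

theorem sum_interleave {M : Type*} [AddCommMonoid M] {k : ℕ} (f g : Fin k → M) (c : M) :
    ∑ i, interleave f g c i = ∑ i, (f i + g i) + c := by
  rw [Fin.sum_univ_castSucc]
  congr 1
  · rw [← (finProdFinEquiv.trans (finCongr (mul_comm k 2))).sum_comp, Fintype.sum_prod_type]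
    refine Finset.sum_congr rfl fun i _ => ?_
    have hi : 1 + 2 * (i : ℕ) < 2 * k := by omega
    have hdiv : (1 + 2 * (i : ℕ)) / 2 = i := by omega
    simp [Fin.sum_univ_two, interleave, hi, hdiv]
  · simp [interleave]

/-- A diagonal matrix plus a rank-one matrix acting on `x`, when the diagonal part maps `x`
to `b`. -/
theorem diagonal_add_vecMulVec_mulVec {n R : Type*} [Fintype n] [DecidableEq n] [CommRing R]
    {d b r x : n → R} (hx : ∀ i, d i * x i = b i) :
    (diagonal d + vecMulVec b r) *ᵥ x = (1 + r ⬝ᵥ x) • b := by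
  ext i
  simp [add_mulVec, mulVec_diagonal, vecMulVec_mulVec, hx]
  ring

theorem smul_ETil_sub_LamTil (k : ℕ) (lam : Fin k → ℝ) (s : ℂ) :
    s • ETil k - LamTil k lam = diagonal (interleave (fun i => s - Complex.I * (lam i : ℂ))
      (fun i => s + Complex.I * (lam i : ℂ)) (-1)) := by
  rw [ETil, LamTil, ← diagonal_smul, diagonal_sub]
  congr 1
  ext i
  simp only [interleave, Pi.smul_apply, smul_eq_mul]
  split_ifs <;> simp

/-- The descriptor realization `(Ẽ, Ã, B̃, C̃)` with `Ã = Λ − B̃R̃`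
realizes the real-symmetric AAA barycentric form: for every `s` distinct from the
support points `± jλ i`, with `D(s) ≠ 0` and `sẼ − Ã` invertible,
`C̃ (sẼ − Ã)⁻¹ B̃ = N(s)/D(s)`. -/
theorem stmt_2 (k : ℕ) (hk : 1 ≤ k) (lam : Fin k → ℝ) (w h : Fin k → ℂ)
    (Atil : Matrix (Fin (2 * k + 1)) (Fin (2 * k + 1)) ℂ)
    (hA : Atil = LamTil k lam - Matrix.vecMulVec (BTil k w) (RTil k))
    (s : ℂ)
    (hs : ∀ i, s ≠ Complex.I * (lam i : ℂ) ∧ s ≠ -(Complex.I * (lam i : ℂ)))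
    (hD : (∑ i, (w i / (s - Complex.I * (lam i : ℂ)) +
        (starRingEnd ℂ) (w i) / (s + Complex.I * (lam i : ℂ)))) ≠ 0)
    (hinv : IsUnit (s • ETil k - Atil)) :
    CTil k h ⬝ᵥ ((s • ETil k - Atil)⁻¹ *ᵥ BTil k w) =
      (∑ i, (h i * w i / (s - Complex.I * (lam i : ℂ)) +
        (starRingEnd ℂ) (h i * w i) / (s + Complex.I * (lam i : ℂ)))) /
      (∑ i, (w i / (s - Complex.I * (lam i : ℂ)) +
        (starRingEnd ℂ) (w i) / (s + Complex.I * (lam i : ℂ)))) := by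
  set D := ∑ i, (w i / (s - Complex.I * (lam i : ℂ)) +
    (starRingEnd ℂ) (w i) / (s + Complex.I * (lam i : ℂ)))
  let x : Fin (2 * k + 1) → ℂ := interleave (fun i => w i / (s - Complex.I * (lam i : ℂ)))
    (fun i => (starRingEnd ℂ) (w i) / (s + Complex.I * (lam i : ℂ))) (-1)
  have hsub (i) : s - Complex.I * (lam i : ℂ) ≠ 0 := sub_ne_zero.2 (hs i).1
  have hadd (i) : s + Complex.I * (lam i : ℂ) ≠ 0 := fun h0 =>
    (hs i).2 (eq_neg_of_add_eq_zero_left h0)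
  have hRx : RTil k ⬝ᵥ x = D - 1 := by
    simp only [dotProduct, RTil, one_mul, x, sum_interleave, sub_eq_add_neg, D]
  have hMx : (s • ETil k - Atil) *ᵥ x = D • BTil k w := by
    rw [hA, sub_sub_eq_add_sub, add_sub_right_comm, smul_ETil_sub_LamTil,
      diagonal_add_vecMulVec_mulVec, hRx, add_sub_cancel]
    intro i
    simp only [interleave, x, BTil]
    split_ifs
    · exact mul_div_cancel₀ _ (hsub _)
    · exact mul_div_cancel₀ _ (hadd _)
    · norm_num
  have hCx : CTil k h ⬝ᵥ x = ∑ i, (h i * w i / (s - Complex.I * (lam i : ℂ)) +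
      (starRingEnd ℂ) (h i * w i) / (s + Complex.I * (lam i : ℂ))) := by
    rw [← add_zero (∑ i, _), ← sum_interleave]
    refine Finset.sum_congr rfl fun i _ => ?_
    simp only [CTil, interleave, x]
    split_ifs <;> simp [mul_div_assoc]
  have hsol : (s • ETil k - Atil)⁻¹ *ᵥ BTil k w = D⁻¹ • x := by
    have : BTil k w = (s • ETil k - Atil) *ᵥ (D⁻¹ • x) := by
      rw [mulVec_smul, hMx, inv_smul_smul₀ hD]
    rw [this, mulVec_mulVec, nonsing_inv_mul _ ((isUnit_iff_isUnit_det _).1 hinv), one_mulVec]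
  rw [hsol, dotProduct_smul, hCx, smul_eq_mul, inv_mul_eq_div]
end

section
/- Let n ≥ 1, let A ∈ ℝ^{n×n}, B ∈ ℝ^{n×1}, C ∈ ℝ^{1×n} be such that (A, B) is controllable, (A, C) is observable, and CB > 0. Assume the numerator polynomial n_F(s) = C·adj(sI_n − A)·B (a real polynomial in s) has no complex root with nonnegative real part, i.e., the strictly proper transfer function F(s) = C(sI_n − A)⁻¹B is minimum phase. Then there exists g ∈ ℝ such that the closed-loop transfer function G(s) = C(sI_n − A + gBC)⁻¹B is strictly positive real. -/
open Matrix

/-- A real matrix mapped entrywise into `ℂ`. -/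
noncomputable def mapC {n : ℕ} (A : Matrix (Fin n) (Fin n) ℝ) :
    Matrix (Fin n) (Fin n) ℂ :=
  A.map fun x => (x : ℂ)

/-- The transfer function `F(s) = D + C (sI − A)⁻¹ B` of the state-space realization
`(A, B, C, D)`, evaluated at `s ∈ ℂ`. -/
noncomputable def transferFn {n : ℕ} (A : Matrix (Fin n) (Fin n) ℝ)
    (B C : Fin n → ℝ) (D : ℝ) (s : ℂ) : ℂ :=
  (D : ℂ) + (fun i => (C i : ℂ)) ⬝ᵥ
    ((s • (1 : Matrix (Fin n) (Fin n) ℂ) - mapC A)⁻¹ *ᵥ fun i => (B i : ℂ))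

/-- `F(s) = D + C(sI − A)⁻¹B` is strictly positive real: there is `τ > 0` such that
`s ↦ F(s − τ)` is positive real, i.e. (i) `(s − τ)I − A` is invertible for `Re s > 0`,
(ii) `F(σ − τ)` is real for real `σ > 0`, (iii) `Re F(s − τ) ≥ 0` for `Re s > 0`. -/
def IsSPR {n : ℕ} (A : Matrix (Fin n) (Fin n) ℝ) (B C : Fin n → ℝ) (D : ℝ) : Prop :=
  ∃ τ : ℝ, 0 < τ ∧
    (∀ s : ℂ, 0 < s.re →
      IsUnit ((s - (τ : ℂ)) • (1 : Matrix (Fin n) (Fin n) ℂ) - mapC A)) ∧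
    (∀ σ : ℝ, 0 < σ → (transferFn A B C D ((σ : ℂ) - (τ : ℂ))).im = 0) ∧
    (∀ s : ℂ, 0 < s.re → 0 ≤ (transferFn A B C D (s - (τ : ℂ))).re)

/-- The pair `(A, B)` is controllable: the controllability matrix
`[B, AB, …, A^{n−1}B]` has full rank `n`. -/
def Controllable {n : ℕ} (A : Matrix (Fin n) (Fin n) ℝ) (B : Fin n → ℝ) : Prop :=
  (Matrix.of fun i j : Fin n => ((A ^ (j : ℕ)) *ᵥ B) i).rank = n


/-- The pair `(A, C)` is observable: the observability matrix
`[Cᵀ, AᵀCᵀ, …, (Aᵀ)^{n−1}Cᵀ]` has full rank `n`. -/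
def Observable {n : ℕ} (A : Matrix (Fin n) (Fin n) ℝ) (C : Fin n → ℝ) : Prop :=
  (Matrix.of fun i j : Fin n => ((Aᵀ ^ (j : ℕ)) *ᵥ C) i).rank = n

open Polynomial in
/-- The numerator `C · adj(XI − A) · B` of the transfer function of `(A, B, C)`. -/
noncomputable def transferNum {n : ℕ} (A : Matrix (Fin n) (Fin n) ℝ) (B C : Fin n → ℝ) : ℝ[X] :=
  (fun i => Polynomial.C (C i)) ⬝ᵥ
    ((Matrix.charmatrix A).adjugate *ᵥ fun i => Polynomial.C (B i))

/-- The **matrix determinant lemma** over a field, in adjugate form. -/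
theorem det_add_vecMulVec_of_field {K m : Type*} [Field K] [Fintype m] [DecidableEq m]
    {M : Matrix m m K} (hM : M.det ≠ 0) (u v : m → K) :
    (M + vecMulVec u v).det = M.det + v ⬝ᵥ (M.adjugate *ᵥ u) := by
  have hentry : (replicateRow Unit v * M⁻¹ * replicateCol Unit u) default default =
      v ⬝ᵥ (M⁻¹ *ᵥ u) := by
    rw [dotProduct_mulVec]
    rfl
  rw [vecMulVec_eq Unit, det_add_replicateCol_mul_replicateRow hM.isUnit,
    det_unique (n := Unit),
    Matrix.add_apply, one_apply_eq, hentry, inv_def, smul_mulVec, dotProduct_smul,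
    Ring.inverse_eq_inv', smul_eq_mul]
  field_simp

/-- The **matrix determinant lemma** over a domain, in adjugate form. -/
theorem det_add_vecMulVec_of_det_ne_zero {R m : Type*} [CommRing R] [IsDomain R]
    [Fintype m] [DecidableEq m] {M : Matrix m m R} (hM : M.det ≠ 0) (u v : m → R) :
    (M + vecMulVec u v).det = M.det + v ⬝ᵥ (M.adjugate *ᵥ u) := by
  let f := algebraMap R (FractionRing R)
  have hf : Function.Injective f := IsFractionRing.injective R (FractionRing R)
  apply hf
  have hdet : (f.mapMatrix M).det ≠ 0 := by
    rw [← f.map_det]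
    exact (map_ne_zero_iff f hf).mpr hM
  have key := det_add_vecMulVec_of_field hdet (f ∘ u) (f ∘ v)
  have hvec : f.mapMatrix (vecMulVec u v) = vecMulVec (f ∘ u) (f ∘ v) := by
    ext i j
    simp [vecMulVec_apply]
  have hmul : f ∘ (M.adjugate *ᵥ u) = (f.mapMatrix M).adjugate *ᵥ (f ∘ u) := by
    ext i
    rw [← f.map_adjugate]
    exact f.map_mulVec _ _ _
  rw [f.map_det, map_add, hvec, key, map_add, f.map_det, f.map_dotProduct, hmul]

open Polynomial in
theorem charpoly_sub_smul_vecMulVec {n : ℕ} (A : Matrix (Fin n) (Fin n) ℝ)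
    (B C : Fin n → ℝ) (g : ℝ) :
    (A - g • vecMulVec B C).charpoly = A.charpoly + Polynomial.C g * transferNum A B C := by
  have hM : (charmatrix A).det ≠ 0 := A.charpoly_monic.ne_zero
  have hchar : charmatrix (A - g • vecMulVec B C) =
      charmatrix A + vecMulVec (Polynomial.C g • fun i => Polynomial.C (B i))
        (fun i => Polynomial.C (C i)) := by
    ext1 i j
    simp [charmatrix, vecMulVec_apply]
    ring
  rw [Matrix.charpoly, hchar, det_add_vecMulVec_of_det_ne_zero hM, mulVec_smul, dotProduct_smul,
    smul_eq_mul]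
  rfl

theorem transferNum_sub_smul_vecMulVec {n : ℕ} (A : Matrix (Fin n) (Fin n) ℝ)
    (B C : Fin n → ℝ) (g : ℝ) :
    transferNum (A - g • vecMulVec B C) B C = transferNum A B C := by
  have h₁ := charpoly_sub_smul_vecMulVec (A - g • vecMulVec B C) B C 1
  have h₂ := charpoly_sub_smul_vecMulVec A B C (g + 1)
  rw [sub_sub, ← add_smul, h₂, charpoly_sub_smul_vecMulVec A B C g] at h₁
  simp only [map_add, map_one] at h₁
  linear_combination -h₁

theorem natDegree_transferNum_le {n : ℕ} (hn : 1 ≤ n) (A : Matrix (Fin n) (Fin n) ℝ)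
    (B C : Fin n → ℝ) : (transferNum A B C).natDegree ≤ n - 1 := by
  have h := charpoly_sub_smul_vecMulVec A B C 1
  rw [map_one, one_mul] at h
  rw [Polynomial.natDegree_le_iff_coeff_eq_zero]
  intro k hk
  have hq : transferNum A B C = (A - (1 : ℝ) • vecMulVec B C).charpoly - A.charpoly := by
    rw [h]; ring
  have hlead (M : Matrix (Fin n) (Fin n) ℝ) : M.charpoly.coeff n = 1 := by
    simpa [Polynomial.Monic, Polynomial.leadingCoeff] using M.charpoly_monic
  rcases (show n ≤ k by omega).eq_or_lt with rfl | hlt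
  · rw [hq, Polynomial.coeff_sub, hlead, hlead, sub_self]
  · rw [hq, Polynomial.coeff_sub, Polynomial.coeff_eq_zero_of_natDegree_lt (by simpa using hlt),
      Polynomial.coeff_eq_zero_of_natDegree_lt (by simpa using hlt), sub_self]

theorem coeff_transferNum {n : ℕ} (hn : 1 ≤ n) (A : Matrix (Fin n) (Fin n) ℝ)
    (B C : Fin n → ℝ) : (transferNum A B C).coeff (n - 1) = C ⬝ᵥ B := by
  have : Nonempty (Fin n) := ⟨⟨0, hn⟩⟩
  have h := congrArg (Polynomial.coeff · (n - 1)) (charpoly_sub_smul_vecMulVec A B C 1)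
  have h₁ := trace_eq_neg_charpoly_coeff (A - (1 : ℝ) • vecMulVec B C)
  have h₂ := trace_eq_neg_charpoly_coeff A
  rw [Fintype.card_fin] at h₁ h₂
  rw [one_smul, trace_sub, trace_vecMulVec] at h₁
  simp only [map_one, one_mul, one_smul, Polynomial.coeff_add] at h
  rw [dotProduct_comm]
  linarith

open Polynomial in
theorem mapMatrix_charmatrix_eq {n : ℕ} (A : Matrix (Fin n) (Fin n) ℝ) (s : ℂ) :
    (aeval s : ℝ[X] →ₐ[ℝ] ℂ).toRingHom.mapMatrix (charmatrix A) =
      s • (1 : Matrix (Fin n) (Fin n) ℂ) - mapC A := by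
  ext i j
  by_cases hij : i = j
  · subst hij; simp [mapC]
  · simp [mapC, hij]

open Polynomial in
theorem aeval_charpoly_eq_det {n : ℕ} (A : Matrix (Fin n) (Fin n) ℝ) (s : ℂ) :
    aeval s A.charpoly = (s • (1 : Matrix (Fin n) (Fin n) ℂ) - mapC A).det := by
  rw [← mapMatrix_charmatrix_eq, ← RingHom.map_det]
  rfl

open Polynomial in
theorem transferFn_eq_div {n : ℕ} (A : Matrix (Fin n) (Fin n) ℝ) (B C : Fin n → ℝ) (s : ℂ) :
    transferFn A B C 0 s = aeval s (transferNum A B C) / aeval s A.charpoly := by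
  let f := (aeval s : ℝ[X] →ₐ[ℝ] ℂ).toRingHom
  have hconst (v : Fin n → ℝ) : (f ∘ fun i => Polynomial.C (v i)) = fun i => (v i : ℂ) := by
    ext i
    simp [f]
  have hnum : aeval s (transferNum A B C) = (fun i => (C i : ℂ)) ⬝ᵥ
      ((s • (1 : Matrix (Fin n) (Fin n) ℂ) - mapC A).adjugate *ᵥ fun i => (B i : ℂ)) := by
    rw [← mapMatrix_charmatrix_eq, ← RingHom.map_adjugate, ← hconst B, ← hconst C]
    change f _ = _
    rw [transferNum, f.map_dotProduct]
    congr 1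
    ext i
    exact f.map_mulVec _ _ _
  rw [transferFn, Matrix.inv_def, hnum, aeval_charpoly_eq_det, smul_mulVec, dotProduct_smul,
    Ring.inverse_eq_inv', smul_eq_mul, div_eq_inv_mul, Complex.ofReal_zero, zero_add]

/-- A product of factors with roots in the open left half-plane dominates the corresponding power
of `1 + ‖s‖` on a half-plane slightly larger than the closed right one. -/
theorem exists_one_add_norm_pow_le_norm_prod (S : Multiset ℂ) (hS : ∀ z ∈ S, z.re < 0) :
    ∃ τ > 0, ∃ K > 0, ∀ s : ℂ, -τ ≤ s.re →
      (1 + ‖s‖) ^ S.card ≤ K * ‖(S.map fun z => s - z).prod‖ := by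
  induction S using Multiset.induction_on with
  | empty => exact ⟨1, one_pos, 1, one_pos, by simp⟩
  | cons z S ih =>
    obtain ⟨τ, hτ, K, hK, h⟩ := ih fun w hw => hS w (Multiset.mem_cons_of_mem hw)
    have hz : 0 < -z.re / 2 := by linarith [hS z (Multiset.mem_cons_self z S)]
    set δ := -z.re / 2 with hδ
    refine ⟨min τ δ, lt_min hτ hz, (1 + (1 + ‖z‖) / δ) * K, by positivity, fun s hs => ?_⟩
    have hs₁ : -τ ≤ s.re := by linarith [min_le_left τ δ]
    have hdist : δ ≤ ‖s - z‖ := by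
      have := (Complex.re_le_norm (s - z))
      rw [Complex.sub_re] at this
      linarith [min_le_right τ δ]
    have hfactor : 1 + ‖s‖ ≤ (1 + (1 + ‖z‖) / δ) * ‖s - z‖ := by
      have h₁ : ‖s‖ ≤ ‖s - z‖ + ‖z‖ := by simpa using norm_add_le (s - z) z
      have h₂ : 1 + ‖z‖ ≤ (1 + ‖z‖) / δ * ‖s - z‖ := by
        rw [div_mul_eq_mul_div, le_div_iff₀ hz]
        gcongr
      linarith
    rw [Multiset.card_cons, Multiset.map_cons, Multiset.prod_cons, norm_mul, pow_succ']
    calc (1 + ‖s‖) * (1 + ‖s‖) ^ S.card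
        ≤ ((1 + (1 + ‖z‖) / δ) * ‖s - z‖) * (K * ‖(S.map fun z => s - z).prod‖) := by
          gcongr
          exact h s hs₁
      _ = _ := by ring

open Polynomial in
theorem exists_norm_eval_le_mul_one_add_norm_pow (r : ℂ[X]) {m : ℕ} (hr : r.natDegree ≤ m) :
    ∃ K, ∀ s : ℂ, ‖r.eval s‖ ≤ K * (1 + ‖s‖) ^ m := by
  refine ⟨∑ i ∈ Finset.range (m + 1), ‖r.coeff i‖, fun s => ?_⟩
  rw [eval_eq_sum_range' (Nat.lt_succ_of_le hr), Finset.sum_mul]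
  refine (norm_sum_le _ _).trans (Finset.sum_le_sum fun i hi => ?_)
  rw [norm_mul, norm_pow]
  gcongr
  calc ‖s‖ ^ i ≤ (1 + ‖s‖) ^ i := by gcongr; linarith
    _ ≤ (1 + ‖s‖) ^ m :=
      pow_le_pow_right₀ (by linarith [norm_nonneg s]) (by simpa [Nat.lt_succ_iff] using hi)

open Polynomial in
/-- A proper quotient `r / q` with all poles in the open left half-plane is bounded on a half-plane
slightly larger than the closed right one. -/
theorem exists_norm_eval_le_mul_norm_eval {q r : ℂ[X]} (hq : q ≠ 0)
    (hroots : ∀ z, q.eval z = 0 → z.re < 0) (hr : r.natDegree ≤ q.natDegree) :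
    ∃ τ > 0, ∃ M, ∀ s : ℂ, -τ ≤ s.re → q.eval s ≠ 0 ∧ ‖r.eval s‖ ≤ M * ‖q.eval s‖ := by
  obtain ⟨τ, hτ, K, hK, h⟩ := exists_one_add_norm_pow_le_norm_prod q.roots
    fun z hz => hroots z (isRoot_of_mem_roots hz)
  have hsplits : q.Splits := IsAlgClosed.splits q
  rw [← hsplits.natDegree_eq_card_roots] at h
  obtain ⟨L, hL⟩ := exists_norm_eval_le_mul_one_add_norm_pow r hr
  have hL₀ : 0 ≤ L := by
    have := (norm_nonneg _).trans (hL 0)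
    simpa using this
  have hlc : 0 < ‖q.leadingCoeff‖ := norm_pos_iff.mpr (leadingCoeff_ne_zero.mpr hq)
  refine ⟨τ, hτ, L * (K / ‖q.leadingCoeff‖), fun s hs => ?_⟩
  have heval : ‖q.eval s‖ = ‖q.leadingCoeff‖ * ‖(q.roots.map fun z => s - z).prod‖ := by
    rw [← norm_mul, hsplits.eval_eq_prod_roots]
  have hle : (1 + ‖s‖) ^ q.natDegree ≤ K / ‖q.leadingCoeff‖ * ‖q.eval s‖ := by
    rw [heval]
    refine (h s hs).trans_eq ?_
    field_simp
  constructor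
  · intro h₀
    rw [h₀, norm_zero, mul_zero] at hle
    exact absurd hle (not_le.mpr (by positivity))
  · calc ‖r.eval s‖ ≤ L * (1 + ‖s‖) ^ q.natDegree := hL s
      _ ≤ L * (K / ‖q.leadingCoeff‖ * ‖q.eval s‖) := by gcongr
      _ = _ := by ring

open Polynomial in
theorem aeval_ofReal_im (p : ℝ[X]) (x : ℝ) : (aeval (x : ℂ) p).im = 0 := by
  have : aeval (x : ℂ) p = ((aeval x p : ℝ) : ℂ) := aeval_algebraMap_apply ℂ x p
  rw [this, Complex.ofReal_im]

/-- minimum phase ⇒ almost strictly positive real.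
If `(A, B)` is controllable, `(A, C)` observable, `CB > 0`, and the numerator
polynomial `n_F(s) = C·adj(sI − A)·B` of the strictly proper transfer function
`F(s) = C(sI − A)⁻¹B` has no complex root with nonnegative real part (minimum phase),
then there is a constant output feedback gain `g ∈ ℝ` such that
`G(s) = C(sI − A + gBC)⁻¹B` is strictly positive real. -/
theorem stmt_7 (n : ℕ) (hn : 1 ≤ n) (A : Matrix (Fin n) (Fin n) ℝ)
    (B C : Fin n → ℝ)
    (hctrb : Controllable A B) (hobs : Observable A C)
    (hCB : 0 < C ⬝ᵥ B)
    (nF : Polynomial ℝ)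
    (hnF : nF = (fun i => Polynomial.C (C i)) ⬝ᵥ
      ((Matrix.charmatrix A).adjugate *ᵥ fun i => Polynomial.C (B i)))
    (hMP : ∀ μ : ℂ, Polynomial.aeval μ nF = 0 → μ.re < 0) :
    ∃ g : ℝ, IsSPR (A - g • Matrix.vecMulVec B C) B C 0 := by
  obtain rfl : nF = transferNum A B C := hnF
  set q := transferNum A B C with hq
  set b := C ⬝ᵥ B
  have hcoeff : q.coeff (n - 1) = b := coeff_transferNum hn A B C
  have hdeg : q.natDegree = n - 1 :=
    Polynomial.natDegree_eq_of_le_of_coeff_ne_zero (natDegree_transferNum_le hn A B C)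
      (by rw [hcoeff]; exact hCB.ne')
  have hq₀ : q ≠ 0 := by
    intro h
    rw [h, Polynomial.coeff_zero] at hcoeff
    exact hCB.ne hcoeff
  set r := Polynomial.C b * A.charpoly - Polynomial.X * q with hr
  have hrdeg : r.natDegree ≤ n - 1 := by
    rw [Polynomial.natDegree_le_iff_coeff_eq_zero]
    intro k hk
    obtain ⟨k, rfl⟩ : ∃ l, k = l + 1 := ⟨k - 1, by omega⟩
    have hlead : A.charpoly.coeff n = 1 := by
      simpa [Polynomial.Monic, Polynomial.leadingCoeff] using A.charpoly_monic
    rw [hr, Polynomial.coeff_sub, Polynomial.coeff_C_mul, Polynomial.coeff_X_mul]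
    rcases (show n - 1 ≤ k by omega).eq_or_lt with rfl | hlt
    · rw [hcoeff, Nat.sub_add_cancel hn, hlead, mul_one, sub_self]
    · rw [Polynomial.coeff_eq_zero_of_natDegree_lt (n := k + 1)
          (by rw [charpoly_natDegree_eq_dim, Fintype.card_fin]; omega),
        Polynomial.coeff_eq_zero_of_natDegree_lt (p := q) (by omega), mul_zero, sub_self]
  let f := algebraMap ℝ ℂ
  obtain ⟨τ, hτ, M, hM⟩ := exists_norm_eval_le_mul_norm_eval (q := q.map f) (r := r.map f)
    (Polynomial.map_ne_zero hq₀)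
    (fun z hz => hMP z (by rwa [Polynomial.eval_map_algebraMap] at hz))
    (by simpa [hdeg] using hrdeg)
  simp only [f, Polynomial.eval_map_algebraMap] at hM
  let g := (τ + M) / b + 1
  have hpos (s : ℂ) (hs : -τ ≤ s.re) :
      0 < ((Polynomial.aeval s A.charpoly + g * Polynomial.aeval s q) /
        Polynomial.aeval s q).re := by
    obtain ⟨hqs, hrs⟩ := hM s hs
    have hb₀ : (b : ℂ) ≠ 0 := by exact_mod_cast hCB.ne'
    have hre : Polynomial.aeval s r = b * Polynomial.aeval s A.charpoly -
        s * Polynomial.aeval s q := by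
      simp [hr]
    have hquot : (Polynomial.aeval s A.charpoly + g * Polynomial.aeval s q) /
        Polynomial.aeval s q =
        ((b⁻¹ : ℝ) : ℂ) * (s + Polynomial.aeval s r / Polynomial.aeval s q) + (g : ℂ) := by
      rw [hre]
      push_cast
      field_simp
      ring
    have hbound : -M ≤ (Polynomial.aeval s r / Polynomial.aeval s q).re := by
      have h := Complex.abs_re_le_norm (Polynomial.aeval s r / Polynomial.aeval s q)
      have hnorm : ‖Polynomial.aeval s r / Polynomial.aeval s q‖ ≤ M := by
        rw [norm_div, div_le_iff₀ (norm_pos_iff.mpr hqs)]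
        exact hrs
      exact (abs_le.mp (h.trans hnorm)).1
    rw [hquot, Complex.add_re, Complex.re_ofReal_mul, Complex.ofReal_re, Complex.add_re]
    have : b⁻¹ * (-τ + -M) ≤ b⁻¹ * (s.re + (Polynomial.aeval s r / Polynomial.aeval s q).re) := by
      gcongr
    have hg : g = -(b⁻¹ * (-τ + -M)) + 1 := by
      simp only [g]
      ring
    linarith
  have hden (s : ℂ) : Polynomial.aeval s (A - g • vecMulVec B C).charpoly =
      Polynomial.aeval s A.charpoly + g * Polynomial.aeval s q := by
    simp [charpoly_sub_smul_vecMulVec, hq]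
  refine ⟨g, τ, hτ, fun s hs => ?_, fun σ _ => ?_, fun s hs => ?_⟩
  · rw [isUnit_iff_isUnit_det, ← aeval_charpoly_eq_det, isUnit_iff_ne_zero, hden]
    intro h
    have := hpos (s - τ) (by simpa using hs.le)
    simp [h] at this
  · rw [transferFn_eq_div, ← Complex.ofReal_sub, Complex.div_im, aeval_ofReal_im, aeval_ofReal_im]
    simp
  · rw [transferFn_eq_div, transferNum_sub_smul_vecMulVec, hden, ← inv_div, Complex.inv_re]
    exact div_nonneg (hpos (s - τ) (by simpa using hs.le)).le (Complex.normSq_nonneg _)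
end

section
/- Let k ≥ 1, let λ_1, …, λ_k be distinct positive real numbers, and let w_i = α_i + jβ_i be nonzero complex numbers and h_i complex numbers, for i = 1, …, k. Define the real matrices 𝒜 = blkdiag(𝒜_1, …, 𝒜_k) ∈ ℝ^{2k×2k} with 𝒜_i = [[0, λ_i], [−λ_i, 0]], the column vector ℬ ∈ ℝ^{2k} with entries (2, 0, 2, 0, …, 2, 0), and the row vector 𝒞 = (α_1, β_1, …, α_k, β_k), so that D(s) = Σ_i ( w_i/(s − jλ_i) + w_i*/(s + jλ_i) ) = 𝒞(sI_{2k} − 𝒜)⁻¹ℬ. Define the polynomials q(s) = Σ_{i=1}^k (2α_i s − 2β_i λ_i) Π_{m≠i}(s² + λ_m²) and p(s) = Σ_{i=1}^k (2 Re(h_i w_i) s − 2 λ_i Im(h_i w_i)) Π_{m≠i}(s² + λ_m²), so that the barycentric model Ĥ(s) = (Σ_i (h_i w_i/(s − jλ_i) + (h_i w_i)*/(s + jλ_i)))/D(s) equals p(s)/q(s). Assume p and q are coprime as complex polynomials and that q has degree 2k−1 (i.e., Ĥ has 2k−1 poles). Then every complex root of q has strictly negative real part (i.e., Ĥ is asymptotically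 stable) if and only if one of the following holds: (1) 𝒞ℬ > 0 and there exists g ∈ ℝ such that G⁺(s) = 𝒞(sI_{2k} − 𝒜 + gℬ𝒞)⁻¹ℬ is strictly positive real; or (2) 𝒞ℬ < 0 and there exists g ∈ ℝ such that G⁻(s) = −𝒞(sI_{2k} − 𝒜 − gℬ𝒞)⁻¹ℬ is strictly positive real. -/
open Matrix

section

open Polynomial

lemma fin_div_two_lt {k : ℕ} (i : Fin (2 * k)) : (i : ℕ) / 2 < k :=
  Nat.div_lt_of_lt_mul i.isLt

/-- The first coordinate of the `i`-th block in `Fin (2 * k)`. -/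
def blockFst {k : ℕ} (i : Fin k) : Fin (2 * k) := ⟨2 * (i : ℕ), by have := i.isLt; omega⟩

/-- The second coordinate of the `i`-th block in `Fin (2 * k)`. -/
def blockSnd {k : ℕ} (i : Fin k) : Fin (2 * k) := ⟨2 * (i : ℕ) + 1, by have := i.isLt; omega⟩

/-- The block-diagonal matrix with blocks `[[0, λᵢ], [−λᵢ, 0]]`. -/
def oscMatrix {k : ℕ} (lam : Fin k → ℝ) : Matrix (Fin (2 * k)) (Fin (2 * k)) ℝ :=
  Matrix.of fun i j : Fin (2 * k) =>
      if (i : ℕ) / 2 = (j : ℕ) / 2 then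
        (if (i : ℕ) % 2 = 0 ∧ (j : ℕ) % 2 = 1 then
          lam ⟨(i : ℕ) / 2, fin_div_two_lt i⟩
         else if (i : ℕ) % 2 = 1 ∧ (j : ℕ) % 2 = 0 then
          -lam ⟨(i : ℕ) / 2, fin_div_two_lt i⟩
         else 0)
      else 0

/-- The input vector `(2, 0, …, 2, 0)`. -/
def oscInput (k : ℕ) : Fin (2 * k) → ℝ := fun i => if (i : ℕ) % 2 = 0 then (2 : ℝ) else 0

/-- The output vector `(α₁, β₁, …, α_k, β_k)` where `wᵢ = αᵢ + jβᵢ`. -/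
def oscOutput {k : ℕ} (w : Fin k → ℂ) : Fin (2 * k) → ℝ := fun i =>
  if (i : ℕ) % 2 = 0 then (w ⟨(i : ℕ) / 2, fin_div_two_lt i⟩).re
  else (w ⟨(i : ℕ) / 2, fin_div_two_lt i⟩).im

/-- The polynomial `∏ᵢ (s² + λᵢ²)`. -/
noncomputable def oscCharpoly {k : ℕ} (lam : Fin k → ℝ) : ℂ[X] :=
  ∏ m, (X ^ 2 + C ((lam m : ℂ) ^ 2))

/-- The numerator of `Σᵢ (wᵢ/(s − jλᵢ) + wᵢ*/(s + jλᵢ))` over `∏ᵢ (s² + λᵢ²)`. -/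
noncomputable def baryNumerator {k : ℕ} (lam : Fin k → ℝ) (w : Fin k → ℂ) : ℂ[X] :=
  ∑ i, (C ((2 * (w i).re : ℝ) : ℂ) * X - C ((2 * (w i).im * lam i : ℝ) : ℂ)) *
    ∏ m ∈ Finset.univ.erase i, (X ^ 2 + C ((lam m : ℂ) ^ 2))

lemma eval_oscCharpoly {k : ℕ} (lam : Fin k → ℝ) (s : ℂ) :
    (oscCharpoly lam).eval s = ∏ m, (s ^ 2 + (lam m : ℂ) ^ 2) := by
  simp [oscCharpoly, eval_prod]

lemma eval_baryNumerator {k : ℕ} (lam : Fin k → ℝ) (w : Fin k → ℂ) (s : ℂ) :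
    (baryNumerator lam w).eval s = ∑ i, (2 * (w i).re * s - 2 * (w i).im * lam i) *
      ∏ m ∈ Finset.univ.erase i, (s ^ 2 + (lam m : ℂ) ^ 2) := by
  simp [baryNumerator, eval_finsetSum, eval_prod]

lemma baryNumerator_neg {k : ℕ} (lam : Fin k → ℝ) (w : Fin k → ℂ) :
    baryNumerator lam (-w) = -baryNumerator lam w := by
  simp only [baryNumerator, ← Finset.sum_neg_distrib]
  refine Finset.sum_congr rfl fun i _ => ?_
  simp only [Pi.neg_apply, Complex.neg_re, Complex.neg_im, mul_neg, neg_mul, Complex.ofReal_neg,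
    map_neg]
  ring

lemma oscOutput_neg {k : ℕ} (w : Fin k → ℂ) : oscOutput (-w) = -oscOutput w := by
  ext i
  simp only [oscOutput, Pi.neg_apply, Complex.neg_re, Complex.neg_im]
  split_ifs <;> rfl

lemma sum_fin_two_mul {M : Type*} [AddCommMonoid M] {k : ℕ} (f : Fin (2 * k) → M) :
    ∑ j, f j = ∑ i, (f (blockFst i) + f (blockSnd i)) := by
  rw [← ((finProdFinEquiv (m := k) (n := 2)).trans (finCongr (mul_comm k 2))).sum_comp,
    Fintype.sum_prod_type]
  refine Finset.sum_congr rfl fun i _ => ?_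
  rw [Fin.sum_univ_two]
  congr 2 <;> ext <;> simp [finProdFinEquiv, blockFst, blockSnd, add_comm]

lemma forall_fin_two_mul {k : ℕ} {P : Fin (2 * k) → Prop} (h0 : ∀ i, P (blockFst i))
    (h1 : ∀ i, P (blockSnd i)) (j : Fin (2 * k)) : P j := by
  rcases Nat.mod_two_eq_zero_or_one j with h | h
  · convert h0 ⟨j / 2, fin_div_two_lt j⟩ using 1
    ext; simp only [blockFst]; omega
  · convert h1 ⟨j / 2, fin_div_two_lt j⟩ using 1
    ext; simp only [blockSnd]; omega

@[simp] lemma oscInput_blockFst {k : ℕ} (i : Fin k) : oscInput k (blockFst i) = 2 := by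
  simp [oscInput, blockFst]

@[simp] lemma oscInput_blockSnd {k : ℕ} (i : Fin k) : oscInput k (blockSnd i) = 0 := by
  simp [oscInput, blockSnd]

@[simp] lemma oscOutput_blockFst {k : ℕ} (w : Fin k → ℂ) (i : Fin k) :
    oscOutput w (blockFst i) = (w i).re := by
  simp [oscOutput, blockFst]

@[simp] lemma oscOutput_blockSnd {k : ℕ} (w : Fin k → ℂ) (i : Fin k) :
    oscOutput w (blockSnd i) = (w i).im := by
  have : (2 * (i : ℕ) + 1) / 2 = i := by omega
  simp [oscOutput, blockSnd, this]

lemma oscMatrix_mulVec_blockFst {k : ℕ} (lam : Fin k → ℝ) (v : Fin (2 * k) → ℂ) (i : Fin k) :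
    (mapC (oscMatrix lam) *ᵥ v) (blockFst i) = lam i * v (blockSnd i) := by
  simp only [Matrix.mulVec, dotProduct, sum_fin_two_mul]
  rw [Finset.sum_eq_single i]
  · have : (2 * (i : ℕ) + 1) / 2 = i := by omega
    simp [mapC, oscMatrix, blockFst, blockSnd, this]
  · intro b _ hb
    have h1 : (2 * (b : ℕ) + 1) / 2 = b := by omega
    have h2 : ¬ (i : ℕ) = b := fun h => hb (Fin.ext h.symm)
    simp [mapC, oscMatrix, blockFst, blockSnd, h1, h2]
  · simp

lemma oscMatrix_mulVec_blockSnd {k : ℕ} (lam : Fin k → ℝ) (v : Fin (2 * k) → ℂ) (i : Fin k) :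
    (mapC (oscMatrix lam) *ᵥ v) (blockSnd i) = -lam i * v (blockFst i) := by
  have h0 : (2 * (i : ℕ) + 1) / 2 = i := by omega
  simp only [Matrix.mulVec, dotProduct, sum_fin_two_mul]
  rw [Finset.sum_eq_single i]
  · simp [mapC, oscMatrix, blockFst, blockSnd, h0]
  · intro b _ hb
    have h1 : (2 * (b : ℕ) + 1) / 2 = b := by omega
    have h2 : ¬ (i : ℕ) = b := fun h => hb (Fin.ext h.symm)
    simp [mapC, oscMatrix, blockFst, blockSnd, h0, h1, h2]
  · simp

lemma oscOutput_dotProduct {k : ℕ} (w : Fin k → ℂ) (v : Fin (2 * k) → ℂ) :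
    (fun i => (oscOutput w i : ℂ)) ⬝ᵥ v =
      ∑ i, ((w i).re * v (blockFst i) + (w i).im * v (blockSnd i)) := by
  simp [dotProduct, sum_fin_two_mul]

/-- The matrix `sI − 𝒜 + gℬ𝒞`. -/
noncomputable def closedLoopPencil {k : ℕ} (lam : Fin k → ℝ) (w : Fin k → ℂ) (g : ℝ) (s : ℂ) :
    Matrix (Fin (2 * k)) (Fin (2 * k)) ℂ :=
  s • (1 : Matrix (Fin (2 * k)) (Fin (2 * k)) ℂ) -
    mapC (oscMatrix lam - g • Matrix.vecMulVec (oscInput k) (oscOutput w))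

lemma closedLoopPencil_mulVec {k : ℕ} (lam : Fin k → ℝ) (w : Fin k → ℂ) (g : ℝ) (s : ℂ)
    (v : Fin (2 * k) → ℂ) (j : Fin (2 * k)) :
    (closedLoopPencil lam w g s *ᵥ v) j = s * v j - (mapC (oscMatrix lam) *ᵥ v) j +
      g * oscInput k j * ((fun i => (oscOutput w i : ℂ)) ⬝ᵥ v) := by
  have : mapC (oscMatrix lam - g • Matrix.vecMulVec (oscInput k) (oscOutput w)) =
      mapC (oscMatrix lam) - (g : ℂ) • Matrix.vecMulVec (fun i => (oscInput k i : ℂ))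
        (fun i => (oscOutput w i : ℂ)) := by
    ext a b
    simp [mapC, Matrix.vecMulVec_apply]
  rw [closedLoopPencil, this]
  simp only [Matrix.sub_mulVec, Matrix.smul_mulVec, Matrix.one_mulVec, Matrix.vecMulVec_mulVec,
    Pi.sub_apply, Pi.smul_apply, smul_eq_mul, MulOpposite.smul_eq_mul_unop, MulOpposite.unop_op]
  ring

lemma dotProduct_mul_of_closedLoopPencil_mulVec {k : ℕ} {lam : Fin k → ℝ} {w : Fin k → ℂ} {g : ℝ}
    {s t : ℂ} {v : Fin (2 * k) → ℂ}
    (hv : closedLoopPencil lam w g s *ᵥ v = fun i => t * (oscInput k i : ℂ)) :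
    ((fun i => (oscOutput w i : ℂ)) ⬝ᵥ v) *
      ((oscCharpoly lam).eval s + g * (baryNumerator lam w).eval s) =
        t * (baryNumerator lam w).eval s := by
  set y := (fun i => (oscOutput w i : ℂ)) ⬝ᵥ v with hy
  have h0 (i : Fin k) : s * v (blockFst i) - lam i * v (blockSnd i) + g * 2 * y = t * 2 := by
    have := congrFun hv (blockFst i)
    rw [closedLoopPencil_mulVec, oscMatrix_mulVec_blockFst] at this
    simpa using this
  have h1 (i : Fin k) : s * v (blockSnd i) + lam i * v (blockFst i) = 0 := by
    have := congrFun hv (blockSnd i)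
    rw [closedLoopPencil_mulVec, oscMatrix_mulVec_blockSnd] at this
    simpa using this
  have key : y * (oscCharpoly lam).eval s = (t - g * y) * (baryNumerator lam w).eval s := by
    rw [eval_oscCharpoly, eval_baryNumerator, Finset.mul_sum]
    conv_lhs => rw [hy, oscOutput_dotProduct, Finset.sum_mul]
    refine Finset.sum_congr rfl fun i _ => ?_
    rw [← Finset.mul_prod_erase _ _ (Finset.mem_univ i), ← mul_assoc, ← mul_assoc]
    congr 1
    linear_combination ((w i).re * s - (w i).im * lam i) * h0 i +
      ((w i).re * lam i + (w i).im * s) * h1 i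
  linear_combination key

lemma sq_add_sq_ne_zero_of_ne {k : ℕ} {lam : Fin k → ℝ} (hlam : Function.Injective lam)
    (hpos : ∀ i, 0 < lam i) {s : ℂ} {i j : Fin k} (hi : s ^ 2 + (lam i : ℂ) ^ 2 = 0)
    (hij : j ≠ i) : s ^ 2 + (lam j : ℂ) ^ 2 ≠ 0 := by
  intro hj
  apply hij (hlam _)
  have : ((lam j ^ 2 : ℝ) : ℂ) = ((lam i ^ 2 : ℝ) : ℂ) := by
    push_cast
    linear_combination hj - hi
  exact (pow_left_inj₀ (hpos j).le (hpos i).le two_ne_zero).1 (Complex.ofReal_injective this)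

lemma eq_zero_of_re_sq_add_im_sq {z : ℂ} (hz : ((z.re : ℂ)) ^ 2 + (z.im : ℂ) ^ 2 = 0) : z = 0 := by
  have : z.re ^ 2 + z.im ^ 2 = 0 := by exact_mod_cast hz
  apply Complex.ext <;> simp <;> nlinarith [sq_nonneg z.re, sq_nonneg z.im]

lemma eval_oscCharpoly_ne_zero_of_isRoot {k : ℕ} {lam : Fin k → ℝ} {w : Fin k → ℂ}
    (hlam : Function.Injective lam) (hpos : ∀ i, 0 < lam i) (hw : ∀ i, w i ≠ 0) {s : ℂ}
    (hs : (baryNumerator lam w).eval s = 0) : (oscCharpoly lam).eval s ≠ 0 := by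
  rw [eval_oscCharpoly]
  intro h
  obtain ⟨i, -, hi⟩ := Finset.prod_eq_zero_iff.1 h
  rw [eval_baryNumerator, Finset.sum_eq_single i] at hs
  · rcases mul_eq_zero.1 hs with h' | h'
    · apply hw i
      apply eq_zero_of_re_sq_add_im_sq
      have hl : (lam i : ℂ) ^ 2 ≠ 0 := pow_ne_zero 2 (by exact_mod_cast (hpos i).ne')
      apply (mul_eq_zero.1 (?_ : (lam i : ℂ) ^ 2 * _ = 0)).resolve_left hl
      linear_combination (w i).re ^ 2 * hi -
        ((w i).re * s + (w i).im * lam i) / 2 * h'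
    · obtain ⟨j, hj, hj0⟩ := Finset.prod_eq_zero_iff.1 h'
      exact sq_add_sq_ne_zero_of_ne hlam hpos hi (Finset.ne_of_mem_erase hj) hj0
  · intro b _ hb
    exact mul_eq_zero_of_right _ (Finset.prod_eq_zero (Finset.mem_erase.2 ⟨hb.symm, by simp⟩) hi)
  · simp

lemma isUnit_closedLoopPencil {k : ℕ} {lam : Fin k → ℝ} {w : Fin k → ℂ}
    (hlam : Function.Injective lam) (hpos : ∀ i, 0 < lam i) (hw : ∀ i, w i ≠ 0) {g : ℝ} {s : ℂ}
    (hs : (oscCharpoly lam).eval s + g * (baryNumerator lam w).eval s ≠ 0) :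
    IsUnit (closedLoopPencil lam w g s) := by
  rw [Matrix.isUnit_iff_isUnit_det, isUnit_iff_ne_zero]
  intro hdet
  obtain ⟨v, hv0, hv⟩ := Matrix.exists_mulVec_eq_zero_iff.2 hdet
  apply hv0
  have hy : (fun i => (oscOutput w i : ℂ)) ⬝ᵥ v = 0 := by
    have := dotProduct_mul_of_closedLoopPencil_mulVec (t := 0) (hv.trans (by ext; simp))
    rw [zero_mul] at this
    exact (mul_eq_zero.1 this).resolve_right hs
  have h0 (i : Fin k) : s * v (blockFst i) - lam i * v (blockSnd i) = 0 := by
    have := congrFun hv (blockFst i)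
    rw [closedLoopPencil_mulVec, oscMatrix_mulVec_blockFst, hy] at this
    simpa using this
  have h1 (i : Fin k) : s * v (blockSnd i) + lam i * v (blockFst i) = 0 := by
    have := congrFun hv (blockSnd i)
    rw [closedLoopPencil_mulVec, oscMatrix_mulVec_blockSnd, hy] at this
    simpa using this
  have hl (i : Fin k) : (lam i : ℂ) ≠ 0 := by exact_mod_cast (hpos i).ne'
  have hfst (i : Fin k) (hi : s ^ 2 + (lam i : ℂ) ^ 2 ≠ 0) : v (blockFst i) = 0 :=
    (mul_eq_zero.1 (by linear_combination s * h0 i + lam i * h1 i :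
      (s ^ 2 + (lam i : ℂ) ^ 2) * v (blockFst i) = 0)).resolve_left hi
  have hsnd (i : Fin k) (hi : v (blockFst i) = 0) : v (blockSnd i) = 0 :=
    (mul_eq_zero.1 (by linear_combination s * hi - h0 i :
      (lam i : ℂ) * v (blockSnd i) = 0)).resolve_left (hl i)
  have hall (i : Fin k) : v (blockFst i) = 0 := by
    by_cases hi : s ^ 2 + (lam i : ℂ) ^ 2 = 0
    · rw [oscOutput_dotProduct, Finset.sum_eq_single i] at hy
      · by_contra hv
        apply hw i
        apply eq_zero_of_re_sq_add_im_sq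
        apply (mul_eq_zero.1 (?_ : (lam i : ℂ) ^ 2 * v (blockFst i) * _ = 0)).resolve_left
          (mul_ne_zero (pow_ne_zero 2 (hl i)) hv)
        linear_combination (lam i * (lam i * (w i).re - s * (w i).im)) * hy +
          (w i).im ^ 2 * v (blockFst i) * hi +
          (lam i * (w i).re * (w i).im - s * (w i).im ^ 2) * h0 i
      · intro b _ hb
        have := hfst b (sq_add_sq_ne_zero_of_ne hlam hpos hi hb)
        simp [this, hsnd b this]
      · simp
    · exact hfst i hi
  funext j
  exact forall_fin_two_mul (P := fun j => v j = 0) hall (fun i => hsnd i (hall i)) j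

lemma transferFn_mul {k : ℕ} {lam : Fin k → ℝ} {w : Fin k → ℂ} {g : ℝ} {s : ℂ}
    (hu : IsUnit (closedLoopPencil lam w g s)) :
    transferFn (oscMatrix lam - g • Matrix.vecMulVec (oscInput k) (oscOutput w)) (oscInput k)
        (oscOutput w) 0 s *
      ((oscCharpoly lam).eval s + g * (baryNumerator lam w).eval s) =
        (baryNumerator lam w).eval s := by
  have h := dotProduct_mul_of_closedLoopPencil_mulVec (lam := lam) (w := w) (g := g) (s := s)
    (t := 1) (v := (closedLoopPencil lam w g s)⁻¹ *ᵥ fun i => (oscInput k i : ℂ)) (by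
      rw [Matrix.mulVec_mulVec, Matrix.mul_nonsing_inv _
        ((Matrix.isUnit_iff_isUnit_det _).1 hu), Matrix.one_mulVec]
      simp)
  rw [one_mul] at h
  rw [transferFn, Complex.ofReal_zero, zero_add]
  exact h

lemma coeff_baryNumerator {k : ℕ} (hk : 1 ≤ k) (lam : Fin k → ℝ) (w : Fin k → ℂ) :
    (baryNumerator lam w).coeff (2 * k - 1) = ((oscOutput w ⬝ᵥ oscInput k : ℝ) : ℂ) := by
  simp only [baryNumerator, finsetSum_coeff, dotProduct, sum_fin_two_mul]
  push_cast
  refine Finset.sum_congr rfl fun i _ => ?_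
  have hm : (∏ m ∈ Finset.univ.erase i, (X ^ 2 + C ((lam m : ℂ) ^ 2))).Monic :=
    monic_prod_of_monic _ _ fun m _ => monic_X_pow_add_C _ two_ne_zero
  have hd : (∏ m ∈ Finset.univ.erase i, (X ^ 2 + C ((lam m : ℂ) ^ 2))).natDegree = 2 * k - 2 := by
    rw [natDegree_prod_of_monic _ _ fun m _ => monic_X_pow_add_C _ two_ne_zero]
    simp only [natDegree_X_pow_add_C, Finset.sum_const, smul_eq_mul, Finset.mem_univ,
      Finset.card_erase_of_mem, Finset.card_univ, Fintype.card_fin]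
    omega
  have h1 := hm.coeff_natDegree
  have h2 := coeff_eq_zero_of_natDegree_lt (hd.trans_lt (by omega : 2 * k - 2 < 2 * k - 1))
  rw [hd] at h1
  rw [sub_mul, coeff_sub, mul_assoc, coeff_C_mul, coeff_C_mul, h2,
    show 2 * k - 1 = (2 * k - 2) + 1 by omega, coeff_X_mul, h1]
  simp
  ring

/-- A polynomial is dominated, on a half-plane to the right of finitely many points, by the monic
polynomial vanishing there, provided its degree is at most the number of points. -/
lemma exists_norm_eval_le_mul_norm_eval_prod (σ : ℝ) (m : Multiset ℂ) :
    (∀ μ ∈ m, μ.re < σ) → ∀ r : ℂ[X], r.natDegree ≤ Multiset.card m →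
      ∃ K : ℝ, 0 ≤ K ∧ ∀ s : ℂ, σ ≤ s.re →
        ‖r.eval s‖ ≤ K * ‖((m.map fun a => X - C a).prod).eval s‖ := by
  induction m using Multiset.induction with
  | empty =>
    intro _ r hr
    obtain ⟨a, rfl⟩ : ∃ a, r = C a := ⟨_, eq_C_of_natDegree_le_zero (by simpa using hr)⟩
    exact ⟨‖a‖, norm_nonneg _, fun s _ => by simp⟩
  | cons a m ih =>
    intro hm r hr
    have ih := ih fun μ hμ => hm μ (Multiset.mem_cons_of_mem hμ)
    have ha : 0 < σ - a.re := sub_pos.2 (hm a (Multiset.mem_cons_self a m))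
    obtain ⟨K, hK, hKb⟩ := ih (r /ₘ (X - C a)) (by
      rw [natDegree_divByMonic _ (monic_X_sub_C a), natDegree_X_sub_C]
      rw [Multiset.card_cons] at hr
      omega)
    obtain ⟨L, hL, hLb⟩ := ih (C (r.eval a)) (by simp)
    refine ⟨K + L / (σ - a.re), by positivity, fun s hs => ?_⟩
    have hs' : σ - a.re ≤ ‖s - a‖ :=
      (by simpa using hs : σ - a.re ≤ (s - a).re).trans (Complex.re_le_norm _)
    have hr : r.eval s = (s - a) * (r /ₘ (X - C a)).eval s + r.eval a := by
      conv_lhs => rw [← modByMonic_add_div r (X - C a), modByMonic_X_sub_C_eq_C_eval]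
      simp [add_comm]
    have h1 := hKb s hs
    have h2 := hLb s hs
    rw [eval_C] at h2
    rw [Multiset.map_cons, Multiset.prod_cons, eval_mul, norm_mul, hr]
    set N := ‖((m.map fun a => X - C a).prod).eval s‖
    have hN : 0 ≤ N := norm_nonneg _
    calc _ ≤ ‖s - a‖ * (K * N) + L * N := by
          refine (norm_add_le _ _).trans (add_le_add ?_ h2)
          rw [norm_mul]
          gcongr
      _ ≤ ‖s - a‖ * (K * N) + L / (σ - a.re) * ‖s - a‖ * N := by
          gcongr
          rw [div_mul_eq_mul_div, le_div_iff₀ ha]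
          gcongr
      _ = _ := by simp; ring

lemma exists_pos_forall_re_lt_neg (m : Multiset ℂ) :
    (∀ μ ∈ m, μ.re < 0) → ∃ τ : ℝ, 0 < τ ∧ ∀ μ ∈ m, μ.re < -τ := by
  induction m using Multiset.induction with
  | empty => exact fun _ => ⟨1, one_pos, by simp⟩
  | cons a m ih =>
    intro h
    obtain ⟨τ, hτ, hm⟩ := ih fun μ hμ => h μ (Multiset.mem_cons_of_mem hμ)
    have ha := h a (Multiset.mem_cons_self a m)
    refine ⟨min τ (-a.re / 2), lt_min hτ (by linarith), fun μ hμ => ?_⟩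
    rcases Multiset.mem_cons.1 hμ with rfl | hμ
    · have := min_le_right τ (-μ.re / 2)
      linarith
    · have := min_le_left τ (-a.re / 2)
      linarith [hm μ hμ]

/-- If `d` is monic of degree one more than a Hurwitz polynomial `q` with positive leading
coefficient, then `Re (d / q)` is bounded below on a half-plane `Re s ≥ −τ` free of zeros of `q`. -/
lemma exists_re_div_bounded_below {d q : ℂ[X]} {c : ℝ} (hc : 0 < c) (hd : d.Monic)
    (hdq : d.natDegree = q.natDegree + 1) (hq : q.leadingCoeff = c)
    (hroots : ∀ μ, q.IsRoot μ → μ.re < 0) :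
    ∃ τ : ℝ, 0 < τ ∧ ∃ M : ℝ, ∀ s : ℂ, -τ ≤ s.re →
      q.eval s ≠ 0 ∧ -M ≤ (d.eval s / q.eval s).re := by
  have hcC : (c : ℂ) ≠ 0 := by exact_mod_cast hc.ne'
  have hq0 : q ≠ 0 := by
    rintro rfl
    exact hcC (by simpa using hq.symm)
  obtain ⟨τ, hτ, hm⟩ := exists_pos_forall_re_lt_neg q.roots fun μ hμ =>
    hroots μ (isRoot_of_mem_roots hμ)
  have hdeg : (C (c : ℂ)⁻¹ * X * q).degree = d.degree := by
    rw [degree_mul, degree_C_mul_X (inv_ne_zero hcC), degree_eq_natDegree hq0,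
      degree_eq_natDegree hd.ne_zero, hdq, add_comm]
    rfl
  have hr : (d - C (c : ℂ)⁻¹ * X * q).natDegree ≤ Multiset.card q.roots := by
    rw [← (IsAlgClosed.splits q).natDegree_eq_card_roots]
    have hlt := degree_sub_lt_left hdeg.symm hd.ne_zero (by
      rw [leadingCoeff_mul, leadingCoeff_mul, hq, hd.leadingCoeff]
      simp [hcC])
    rw [degree_eq_natDegree hd.ne_zero, hdq] at hlt
    by_cases h0 : d - C (c : ℂ)⁻¹ * X * q = 0
    · simp [h0]
    · rw [degree_eq_natDegree h0] at hlt
      exact Nat.lt_succ_iff.1 (by exact_mod_cast hlt)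
  obtain ⟨K, hK, hKb⟩ := exists_norm_eval_le_mul_norm_eval_prod (-τ) q.roots hm _ hr
  refine ⟨τ, hτ, τ / c + K / c, fun s hs => ?_⟩
  have hqs : q.eval s ≠ 0 := fun h =>
    absurd (hm s ((mem_roots hq0).2 h)) (not_lt.2 hs)
  refine ⟨hqs, ?_⟩
  have hfac : q.eval s = c * ((q.roots.map fun a => X - C a).prod).eval s := by
    conv_lhs => rw [(IsAlgClosed.splits q).eq_prod_roots, hq]
    simp
  set r := d - C (c : ℂ)⁻¹ * X * q with hrdef
  have hdiv : d.eval s / q.eval s = ((c⁻¹ : ℝ) : ℂ) * s + r.eval s / q.eval s := by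
    rw [hrdef]
    push_cast
    simp only [eval_sub, eval_mul, eval_C, eval_X]
    field_simp
    ring
  have hb : ‖r.eval s / q.eval s‖ ≤ K / c := by
    rw [norm_div, div_le_iff₀ (norm_pos_iff.2 hqs), hfac, norm_mul, Complex.norm_real,
      Real.norm_of_nonneg hc.le]
    refine (hKb s hs).trans_eq ?_
    field_simp
  have h1 := (abs_le.1 ((Complex.abs_re_le_norm _).trans hb)).1
  have h2 : -(τ / c) ≤ c⁻¹ * s.re := by
    rw [← neg_div, div_eq_inv_mul]
    gcongr
  rw [hdiv, Complex.add_re, Complex.re_ofReal_mul]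
  linarith

lemma monic_oscCharpoly {k : ℕ} (lam : Fin k → ℝ) : (oscCharpoly lam).Monic :=
  monic_prod_of_monic _ _ fun _ _ => monic_X_pow_add_C _ two_ne_zero

lemma natDegree_oscCharpoly {k : ℕ} (lam : Fin k → ℝ) : (oscCharpoly lam).natDegree = 2 * k := by
  rw [oscCharpoly, natDegree_prod_of_monic _ _ fun m _ => monic_X_pow_add_C _ two_ne_zero]
  simp only [natDegree_X_pow_add_C, Finset.sum_const, Finset.card_univ, Fintype.card_fin, smul_eq_mul,
    mul_comm]

lemma exists_isSPR_of_roots_re_neg {k : ℕ} (hk : 1 ≤ k) {lam : Fin k → ℝ} {w : Fin k → ℂ}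
    (hlam : Function.Injective lam) (hpos : ∀ i, 0 < lam i) (hw : ∀ i, w i ≠ 0)
    (hdeg : (baryNumerator lam w).natDegree = 2 * k - 1)
    (hCB : 0 < oscOutput w ⬝ᵥ oscInput k)
    (hroots : ∀ μ, (baryNumerator lam w).IsRoot μ → μ.re < 0) :
    ∃ g : ℝ, IsSPR (oscMatrix lam - g • Matrix.vecMulVec (oscInput k) (oscOutput w))
      (oscInput k) (oscOutput w) 0 := by
  obtain ⟨τ, hτ, M, hM⟩ := exists_re_div_bounded_below hCB (monic_oscCharpoly lam)
    (by rw [natDegree_oscCharpoly, hdeg]; omega)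
    (by rw [leadingCoeff, hdeg, coeff_baryNumerator hk]) hroots
  set g : ℝ := M + 1 with hg
  have hre (s : ℂ) (hs : -τ ≤ s.re) :
      1 ≤ ((oscCharpoly lam).eval s / (baryNumerator lam w).eval s + g).re := by
    rw [Complex.add_re, Complex.ofReal_re]
    linarith [(hM s hs).2]
  have hne (s : ℂ) (hs : -τ ≤ s.re) :
      (oscCharpoly lam).eval s + g * (baryNumerator lam w).eval s ≠ 0 := by
    intro h
    have h' : (oscCharpoly lam).eval s / (baryNumerator lam w).eval s + g = 0 := by
      have := (hM s hs).1
      field_simp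
      linear_combination h
    have := hre s hs
    rw [h', Complex.zero_re] at this
    linarith
  have hG (s : ℂ) (hs : -τ ≤ s.re) :
      transferFn (oscMatrix lam - g • Matrix.vecMulVec (oscInput k) (oscOutput w)) (oscInput k)
        (oscOutput w) 0 s =
      ((oscCharpoly lam).eval s / (baryNumerator lam w).eval s + g)⁻¹ := by
    have h1 := transferFn_mul (isUnit_closedLoopPencil hlam hpos hw (hne s hs))
    rw [eq_div_of_mul_eq (hne s hs) h1, ← one_div, div_eq_div_iff (hne s hs)]
    · have := (hM s hs).1
      field_simp
    · intro h0
      have := hre s hs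
      rw [h0, Complex.zero_re] at this
      linarith
  refine ⟨g, τ, hτ, fun s hs => ?_, fun σ hσ => ?_, fun s hs => ?_⟩
  · exact isUnit_closedLoopPencil hlam hpos hw (hne _ (by simpa using hs.le))
  · rw [hG _ (by simpa using hσ.le), ← Complex.ofReal_sub, eval_oscCharpoly, eval_baryNumerator]
    generalize σ - τ = t
    norm_cast
  · rw [hG _ (by simpa using hs.le), Complex.inv_re]
    exact div_nonneg (zero_le_one.trans (hre _ (by simpa using hs.le))) (Complex.normSq_nonneg _)

lemma re_neg_of_isSPR {k : ℕ} {lam : Fin k → ℝ} {w : Fin k → ℂ}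
    (hlam : Function.Injective lam) (hpos : ∀ i, 0 < lam i) (hw : ∀ i, w i ≠ 0)
    (hq0 : baryNumerator lam w ≠ 0) {g : ℝ}
    (hspr : IsSPR (oscMatrix lam - g • Matrix.vecMulVec (oscInput k) (oscOutput w))
      (oscInput k) (oscOutput w) 0) {μ : ℂ} (hμ : (baryNumerator lam w).IsRoot μ) : μ.re < 0 := by
  obtain ⟨τ, hτ, hunit, -, hre⟩ := hspr
  by_contra! hμ0
  set H : Set ℂ := {s | -τ < s.re}
  have hHopen : IsOpen H := isOpen_lt continuous_const Complex.continuous_re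
  have hHconn : IsPreconnected H := (convex_halfSpace_re_gt (-τ)).isPreconnected
  have hμH : μ ∈ H := by show -τ < μ.re; linarith
  have hu {s : ℂ} (hs : s ∈ H) : IsUnit (closedLoopPencil lam w g s) := by
    have hs : -τ < s.re := hs
    simpa [closedLoopPencil] using hunit (s + τ) (by simp; linarith)
  have hne {s : ℂ} (hs : s ∈ H) :
      (oscCharpoly lam).eval s + g * (baryNumerator lam w).eval s ≠ 0 := by
    intro h0
    have h := transferFn_mul (hu hs)
    rw [h0, mul_zero] at h
    refine eval_oscCharpoly_ne_zero_of_isRoot hlam hpos hw h.symm ?_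
    rwa [← h, mul_zero, add_zero] at h0
  set f : ℂ → ℂ := fun s => (baryNumerator lam w).eval s /
    ((oscCharpoly lam).eval s + g * (baryNumerator lam w).eval s) with hf
  have hfre {s : ℂ} (hs : s ∈ H) : 0 ≤ (f s).re := by
    have h := hre (s + τ) (by have : -τ < s.re := hs; simp; linarith)
    rw [add_sub_cancel_right] at h
    rwa [eq_div_of_mul_eq (hne hs) (transferFn_mul (hu hs))] at h
  have hfμ : f μ = 0 := by simp [hf, hμ.eq_zero]
  have hfan : AnalyticOnNhd ℂ f H := by
    refine DifferentiableOn.analyticOnNhd (fun s hs => ?_) hHopen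
    exact ((baryNumerator lam w).differentiableAt.div
      ((oscCharpoly lam).differentiableAt.add
        ((baryNumerator lam w).differentiableAt.const_mul _)) (hne hs)).differentiableWithinAt
  rcases hfan.is_constant_or_isOpen hHconn with ⟨z, hz⟩ | hopen
  · apply hq0
    refine eq_zero_of_infinite_isRoot _ (Set.Infinite.mono (s := H) (fun s hs => ?_) ?_)
    · have h := hz s hs
      rw [← hz μ hμH, hfμ] at h
      exact (div_eq_zero_iff.1 h).resolve_right (hne hs)
    · exact infinite_of_mem_nhds μ (hHopen.mem_nhds hμH)
  · have himg : IsOpen (f '' H) := hopen H subset_rfl hHopen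
    obtain ⟨ε, hε, hball⟩ := Metric.isOpen_iff.1 himg 0 ⟨μ, hμH, hfμ⟩
    obtain ⟨s, hs, hfs⟩ := hball (show ((-(ε / 2) : ℝ) : ℂ) ∈ Metric.ball 0 ε by
      rw [mem_ball_zero_iff, Complex.norm_real, norm_neg, Real.norm_of_nonneg (by positivity)]
      linarith)
    have := hfre hs
    rw [hfs, Complex.ofReal_re] at this
    linarith

end

open Polynomial in
/-- stability characterization for real-valued AAA models.
Let `λ₁, …, λ_k` be distinct positive reals and `w_i = α_i + jβ_i` nonzero complex
weights. With the minimal real realization `(𝒜, ℬ, 𝒞)` of the barycentric denominator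
`D(s) = Σ_i (w_i/(s − jλ_i) + w_i*/(s + jλ_i))` — where `𝒜 = blkdiag([[0,λ_i],[−λ_i,0]])`,
`ℬ = (2,0,…,2,0)ᵀ`, `𝒞 = (α₁,β₁,…,α_k,β_k)` — and the numerator polynomials `p`, `q`
of the barycentric model `Ĥ = p/q`, assume `p` and `q` are coprime over `ℂ` and
`deg q = 2k − 1`. Then all roots of `q` have negative real part (i.e. `Ĥ` is
asymptotically stable) iff either `𝒞ℬ > 0` and `G⁺(s) = 𝒞(sI − 𝒜 + gℬ𝒞)⁻¹ℬ` is SPR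
for some real `g`, or `𝒞ℬ < 0` and `G⁻(s) = −𝒞(sI − 𝒜 − gℬ𝒞)⁻¹ℬ` is SPR for some
real `g`. -/
theorem stmt_8 (k : ℕ) (hk : 1 ≤ k) (lam : Fin k → ℝ) (w h : Fin k → ℂ)
    (hlam : Function.Injective lam) (hlampos : ∀ i, 0 < lam i)
    (hw : ∀ i, w i ≠ 0)
    (calA : Matrix (Fin (2 * k)) (Fin (2 * k)) ℝ)
    (hcalA : calA = Matrix.of fun i j : Fin (2 * k) =>
      if (i : ℕ) / 2 = (j : ℕ) / 2 then
        (if (i : ℕ) % 2 = 0 ∧ (j : ℕ) % 2 = 1 then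
          lam ⟨(i : ℕ) / 2, by have := i.isLt; omega⟩
         else if (i : ℕ) % 2 = 1 ∧ (j : ℕ) % 2 = 0 then
          -lam ⟨(i : ℕ) / 2, by have := i.isLt; omega⟩
         else 0)
      else 0)
    (calB : Fin (2 * k) → ℝ)
    (hcalB : calB = fun i : Fin (2 * k) => if (i : ℕ) % 2 = 0 then (2 : ℝ) else 0)
    (calC : Fin (2 * k) → ℝ)
    (hcalC : calC = fun i : Fin (2 * k) =>
      if (i : ℕ) % 2 = 0 then (w ⟨(i : ℕ) / 2, by have := i.isLt; omega⟩).re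
      else (w ⟨(i : ℕ) / 2, by have := i.isLt; omega⟩).im)
    (q p : Polynomial ℂ)
    (hq : q = ∑ i, (Polynomial.C ((2 * (w i).re : ℝ) : ℂ) * X -
        Polynomial.C ((2 * (w i).im * lam i : ℝ) : ℂ)) *
        ∏ m ∈ Finset.univ.erase i, (X ^ 2 + Polynomial.C ((lam m : ℂ) ^ 2)))
    (hp : p = ∑ i, (Polynomial.C ((2 * (h i * w i).re : ℝ) : ℂ) * X -
        Polynomial.C ((2 * lam i * (h i * w i).im : ℝ) : ℂ)) *
        ∏ m ∈ Finset.univ.erase i, (X ^ 2 + Polynomial.C ((lam m : ℂ) ^ 2)))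
    (hcoprime : IsCoprime p q)
    (hdeg : q.degree = (2 * k - 1 : ℕ)) :
    (∀ μ : ℂ, q.IsRoot μ → μ.re < 0) ↔
      ((0 < calC ⬝ᵥ calB ∧
          ∃ g : ℝ, IsSPR (calA - g • Matrix.vecMulVec calB calC) calB calC 0) ∨
       (calC ⬝ᵥ calB < 0 ∧
          ∃ g : ℝ, IsSPR (calA + g • Matrix.vecMulVec calB calC) calB (-calC) 0)) := by
  change calA = oscMatrix lam at hcalA
  change calB = oscInput k at hcalB
  change calC = oscOutput w at hcalC
  change q = baryNumerator lam w at hq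
  subst hcalA hcalB hcalC hq
  have hq0 : baryNumerator lam w ≠ 0 := by
    intro h0
    simp [h0] at hdeg
  have hdeg' : (baryNumerator lam w).natDegree = 2 * k - 1 := natDegree_eq_of_degree_eq_some hdeg
  have hnw : ∀ i, (-w) i ≠ 0 := fun i => neg_ne_zero.2 (hw i)
  have hshift (g : ℝ) : oscMatrix lam + g • Matrix.vecMulVec (oscInput k) (oscOutput w) =
      oscMatrix lam - g • Matrix.vecMulVec (oscInput k) (oscOutput (-w)) := by
    rw [oscOutput_neg, Matrix.vecMulVec_neg, smul_neg, sub_neg_eq_add]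
  have hroot (μ : ℂ) : (baryNumerator lam (-w)).IsRoot μ ↔ (baryNumerator lam w).IsRoot μ := by
    simp [baryNumerator_neg]
  simp only [hshift, ← oscOutput_neg]
  constructor
  · intro hroots
    have hne : oscOutput w ⬝ᵥ oscInput k ≠ 0 := by
      intro h0
      apply leadingCoeff_ne_zero.2 hq0
      rw [leadingCoeff, hdeg', coeff_baryNumerator hk, h0, Complex.ofReal_zero]
    rcases hne.lt_or_gt with hneg | hgt
    · refine Or.inr ⟨hneg, exists_isSPR_of_roots_re_neg hk hlam hlampos hnw ?_ ?_ ?_⟩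
      · rw [baryNumerator_neg, natDegree_neg, hdeg']
      · rw [oscOutput_neg, neg_dotProduct]
        exact neg_pos.2 hneg
      · exact fun μ hμ => hroots μ ((hroot μ).1 hμ)
    · exact Or.inl ⟨hgt, exists_isSPR_of_roots_re_neg hk hlam hlampos hw hdeg' hgt hroots⟩
  · rintro (⟨-, g, hg⟩ | ⟨-, g, hg⟩) μ hμ
    · exact re_neg_of_isSPR hlam hlampos hw hq0 hg hμ
    · refine re_neg_of_isSPR hlam hlampos hnw ?_ hg ((hroot μ).2 hμ)
      rw [baryNumerator_neg]
      exact neg_ne_zero.2 hq0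
end

section
/- Let n ≥ 1, let A ∈ ℝ^{n×n}, let B, x̄ ∈ ℝⁿ, g ∈ ℝ, r ∈ ℝ and η > 0. Suppose Y ∈ ℝ^{n×n} is symmetric positive definite, the matrix YAᵀ + AY − 2g·BBᵀ is negative definite, and the (n+1)×(n+1) block matrix [[r, (B − Yx̄)ᵀ], [B − Yx̄, 2Y − η·I_n]] is positive semidefinite. Then, setting Q = Y⁻¹: Q is symmetric positive definite, the matrix AᵀQ + QA − 2g·QBBᵀQ is negative definite, and r ≥ η·‖QB − x̄‖₂². In other words, every feasible point of the relaxed convex program yields a feasible point of the original non-convex stability-constrained program with Q = Y⁻¹, together with the cost bound r ≥ η‖QB − x̄‖₂². -/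
open Matrix

/-- The symmetric `(1+n)×(1+n)` block matrix `[[r, vᵀ], [v, M]]`. -/
def blockMat (n : ℕ) (r : ℝ) (v : Fin n → ℝ) (M : Matrix (Fin n) (Fin n) ℝ) :
    Matrix (Fin 1 ⊕ Fin n) (Fin 1 ⊕ Fin n) ℝ :=
  Matrix.fromBlocks (Matrix.of fun _ _ => r) (Matrix.of fun _ j => v j)
    (Matrix.of fun i _ => v i) M

/-- The quadratic form of a block matrix at a vector `(1, -w)`. -/
theorem dotProduct_blockMat_mulVec (n : ℕ) (r : ℝ) (v w : Fin n → ℝ)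
    (M : Matrix (Fin n) (Fin n) ℝ) :
    Sum.elim (fun _ : Fin 1 => (1 : ℝ)) (-w) ⬝ᵥ
        (blockMat n r v M *ᵥ Sum.elim (fun _ : Fin 1 => (1 : ℝ)) (-w)) =
      r - 2 * (w ⬝ᵥ v) + w ⬝ᵥ (M *ᵥ w) := by
  have hr : (Matrix.of fun (_ _ : Fin 1) => r) *ᵥ (fun _ => (1 : ℝ)) = fun _ => r := by
    ext i; simp [mulVec, dotProduct]
  have hrow : (Matrix.of fun (_ : Fin 1) j => v j) *ᵥ (-w) = fun _ => -(w ⬝ᵥ v) := by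
    ext i; simp [mulVec, dotProduct, mul_comm]
  have hcol : (Matrix.of fun i (_ : Fin 1) => v i) *ᵥ (fun _ => (1 : ℝ)) = v := by
    ext i; simp [mulVec, dotProduct]
  rw [blockMat, fromBlocks_mulVec]
  simp only [Sum.elim_comp_inl, Sum.elim_comp_inr, sumElim_dotProduct_sumElim, hr, hrow, hcol,
    mulVec_neg, neg_dotProduct, dotProduct_add, dotProduct_neg]
  simp [dotProduct]
  ring

/-- feasibility transfer from the relaxed convex program to the exact
non-convex program. Suppose `Y ≻ 0`, `YAᵀ + AY − 2g·BBᵀ ≺ 0`, and the block matrix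
`[[r, (B − Yx̄)ᵀ], [B − Yx̄, 2Y − ηI]]` is positive semidefinite with `η > 0`. Then,
with `Q = Y⁻¹`: `Q` is symmetric positive definite, `AᵀQ + QA − 2g·QBBᵀQ ≺ 0`, and
`r ≥ η·‖QB − x̄‖₂²`. -/
theorem stmt_15 (n : ℕ) (hn : 1 ≤ n) (A : Matrix (Fin n) (Fin n) ℝ)
    (B xbar : Fin n → ℝ) (g r η : ℝ) (hη : 0 < η)
    (Y : Matrix (Fin n) (Fin n) ℝ) (hY : Y.PosDef)
    (hLMI : (-(Y * Aᵀ + A * Y - (2 * g) • Matrix.vecMulVec B B)).PosDef)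
    (hblk : (blockMat n r (B - Y *ᵥ xbar)
      ((2 : ℝ) • Y - η • (1 : Matrix (Fin n) (Fin n) ℝ))).PosSemidef) :
    (Y⁻¹).PosDef ∧
    (-(Aᵀ * Y⁻¹ + Y⁻¹ * A -
        (2 * g) • (Y⁻¹ * Matrix.vecMulVec B B * Y⁻¹))).PosDef ∧
    η * ∑ i, ((Y⁻¹ *ᵥ B - xbar) i) ^ 2 ≤ r := by
  have hdet : IsUnit Y.det := (isUnit_iff_isUnit_det Y).mp hY.isUnit
  have hQ : (Y⁻¹).PosDef := hY.inv
  refine ⟨hQ, ?_, ?_⟩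
  · have h := hLMI.conjTranspose_mul_mul_same (mulVec_injective_of_isUnit hQ.isUnit)
    rw [hQ.isHermitian.eq] at h
    convert h using 1
    have hl : Y⁻¹ * (Y * Aᵀ) * Y⁻¹ = Aᵀ * Y⁻¹ := by
      rw [nonsing_inv_mul_cancel_left Y _ hdet]
    have hr : Y⁻¹ * (A * Y) * Y⁻¹ = Y⁻¹ * A := by
      rw [← mul_assoc, mul_nonsing_inv_cancel_right Y _ hdet]
    simp only [mul_neg, neg_mul, mul_sub, sub_mul, mul_add, add_mul, hl, hr, Matrix.mul_smul,
      Matrix.smul_mul]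
  · set w := Y⁻¹ *ᵥ B - xbar with hw
    have hv : B - Y *ᵥ xbar = Y *ᵥ w := by
      rw [hw, mulVec_sub, mulVec_mulVec, mul_nonsing_inv Y hdet, one_mulVec]
    have h := hblk.dotProduct_mulVec_nonneg (Sum.elim (fun _ => 1) (-w))
    rw [star_trivial, dotProduct_blockMat_mulVec, hv, sub_mulVec, smul_mulVec, smul_mulVec,
      one_mulVec, dotProduct_sub, dotProduct_smul, dotProduct_smul, smul_eq_mul,
      smul_eq_mul] at h
    have hsq : ∑ i, w i ^ 2 = w ⬝ᵥ w := by simp only [dotProduct, sq]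
    rw [hsq]
    linarith
end
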